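/- Let G = (V, w) be a weighted graph with n vertices where every edge has weight at most τ, let d = min_{u∈V} w(Δ_G({u})) be the minimum weighted degree, fix 0 ≤ ε < 1, and let T = {X : |X|, |V\X| ≥ 2 and w(Δ_G(X)) ≤ λ(G) + εd} be the shores of all non-star near-minimum cuts. Let G' = Contract(G, atoms(T)). Then the total edge weight of G' satisfies w(E(G')) ≤ 68τn/(1-ε)². -/

import Mathlib

/-- `u` and `v` lie in the same atom of the family `T` of subsets of `V`. -/
def sameAtom {V : Type*} (T : Set (Set V)) (u v : V) : Prop :=
  ∀ X ∈ T, (u ∈ X ↔ v ∈ X)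

open Classical in
/-- The weight of the cut with shore `X` in the weighted graph `(V, w)`. -/
noncomputable def cutWeight {V : Type*} [Fintype V] (w : V → V → ℝ) (X : Set V) : ℝ :=
  ∑ u : V, ∑ v : V, if u ∈ X ∧ v ∉ X then w u v else 0

theorem sameAtom_symm' {V : Type*} {T : Set (Set V)} {u v : V} (h : sameAtom T u v) :
    sameAtom T v u := fun X hX => (h X hX).symm

theorem sameAtom_trans' {V : Type*} {T : Set (Set V)} {u v x : V} (h : sameAtom T u v)
    (h' : sameAtom T v x) : sameAtom T u x := fun X hX => (h X hX).trans (h' X hX)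

open Classical in
/-- The atom of `v`, as a finset. -/
noncomputable def atomF {V : Type*} [Fintype V] (F : Finset (Set V)) (v : V) : Finset V :=
  Finset.univ.filter (fun u => sameAtom (F : Set (Set V)) v u)

theorem mem_atomF {V : Type*} [Fintype V] (F : Finset (Set V)) (v u : V) :
    u ∈ atomF F v ↔ sameAtom (F : Set (Set V)) v u := by
  classical
  simp [atomF]

theorem self_mem_atomF {V : Type*} [Fintype V] (F : Finset (Set V)) (v : V) :
    v ∈ atomF F v := by
  rw [mem_atomF]; intro X _; exact Iff.rfl

theorem atomF_eq {V : Type*} [Fintype V] (F : Finset (Set V)) {v u : V}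
    (h : u ∈ atomF F v) : atomF F u = atomF F v := by
  rw [mem_atomF] at h
  ext x
  rw [mem_atomF, mem_atomF]
  exact ⟨fun h' => sameAtom_trans' h h', fun h' => sameAtom_trans' (sameAtom_symm' h) h'⟩

/-- Potential function: each atom `A` contributes `max 0 (|A|/θ - 1)`. -/
noncomputable def pot {V : Type*} [Fintype V] (θ : ℝ) (F : Finset (Set V)) : ℝ :=
  ∑ v : V, max 0 (1 / θ - 1 / ((atomF F v).card : ℝ))

theorem atomF_card_pos {V : Type*} [Fintype V] (F : Finset (Set V)) (v : V) :
    (0 : ℝ) < (atomF F v).card := by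
  exact_mod_cast Finset.card_pos.mpr ⟨v, self_mem_atomF F v⟩

open Classical in
theorem pot_step {V : Type*} [Fintype V] (θ : ℝ) (hθ : 0 < θ) (F : Finset (Set V)) (X : Set V)
    (a : V) (h1 : θ ≤ ((atomF F a).filter (fun u => u ∈ X)).card)
    (h2 : θ ≤ ((atomF F a).filter (fun u => u ∉ X)).card) :
    pot θ (insert X F) + 1 ≤ pot θ F := by
  have hsub : ∀ v, atomF (insert X F) v ⊆ atomF F v := by
    intro v u hu
    rw [mem_atomF] at *
    intro Y hY
    exact hu Y (by simp at hY ⊢; exact Or.inr hY)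
  have hin : ∀ v ∈ (atomF F a).filter (fun u => u ∈ X),
      atomF (insert X F) v = (atomF F a).filter (fun u => u ∈ X) := by
    intro v hv
    rw [Finset.mem_filter] at hv
    ext u
    rw [Finset.mem_filter, ← atomF_eq F hv.1, mem_atomF, mem_atomF]
    simp only [sameAtom, Finset.coe_insert, Set.mem_insert_iff, forall_eq_or_imp]
    have := hv.2
    tauto
  have hout : ∀ v ∈ (atomF F a).filter (fun u => u ∉ X),
      atomF (insert X F) v = (atomF F a).filter (fun u => u ∉ X) := by
    intro v hv
    rw [Finset.mem_filter] at hv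
    ext u
    rw [Finset.mem_filter, ← atomF_eq F hv.1, mem_atomF, mem_atomF]
    simp only [sameAtom, Finset.coe_insert, Set.mem_insert_iff, forall_eq_or_imp]
    have := hv.2
    tauto
  set A := atomF F a with hA
  set A1 := A.filter (fun u => u ∈ X) with hA1
  set A2 := A.filter (fun u => u ∉ X) with hA2
  have hcard : (A1.card : ℝ) + A2.card = A.card := by
    exact_mod_cast Finset.card_filter_add_card_filter_not (s := A) (fun u => u ∈ X)
  have hc1 : (0 : ℝ) < A1.card := lt_of_lt_of_le hθ h1
  have hc2 : (0 : ℝ) < A2.card := lt_of_lt_of_le hθ h2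
  have key : ∀ (c : ℝ), θ ≤ c → max 0 (1 / θ - 1 / c) = 1 / θ - 1 / c := by
    intro c hc
    apply max_eq_right
    have := one_div_le_one_div_of_le hθ hc
    linarith
  unfold pot
  rw [← Finset.sum_filter_add_sum_filter_not Finset.univ (fun v => v ∈ A)
      (fun v => max 0 (1 / θ - 1 / ((atomF (insert X F) v).card : ℝ))),
    ← Finset.sum_filter_add_sum_filter_not Finset.univ (fun v => v ∈ A)
      (fun v => max 0 (1 / θ - 1 / ((atomF F v).card : ℝ)))]
  have hrest : ∑ v ∈ Finset.univ.filter (fun v => v ∉ A),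
        max 0 (1 / θ - 1 / ((atomF (insert X F) v).card : ℝ)) ≤
      ∑ v ∈ Finset.univ.filter (fun v => v ∉ A),
        max 0 (1 / θ - 1 / ((atomF F v).card : ℝ)) := by
    apply Finset.sum_le_sum
    intro v _
    apply max_le_max le_rfl
    have h3 : ((atomF (insert X F) v).card : ℝ) ≤ (atomF F v).card := by
      exact_mod_cast Finset.card_le_card (hsub v)
    have := one_div_le_one_div_of_le (atomF_card_pos (insert X F) v) h3
    linarith
  have hfA : Finset.univ.filter (fun v => v ∈ A) = A := by ext; simp
  rw [hfA]
  have e1 : ∑ v ∈ A, max 0 (1 / θ - 1 / ((atomF F v).card : ℝ)) = A.card / θ - 1 := by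
    have : ∀ v ∈ A, max 0 (1 / θ - 1 / ((atomF F v).card : ℝ)) = 1 / θ - 1 / A.card := by
      intro v hv
      rw [atomF_eq F hv]
      exact key _ (by linarith)
    rw [Finset.sum_congr rfl this, Finset.sum_const, nsmul_eq_mul]
    have : (A.card : ℝ) ≠ 0 := by linarith
    field_simp
  have e2 : ∑ v ∈ A, max 0 (1 / θ - 1 / ((atomF (insert X F) v).card : ℝ))
      = (A1.card / θ - 1) + (A2.card / θ - 1) := by
    rw [← Finset.sum_filter_add_sum_filter_not A (fun v => v ∈ X)]
    congr 1
    · rw [← hA1, Finset.sum_congr rfl (fun v hv => by rw [hin v hv, key _ h1]),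
        Finset.sum_const, nsmul_eq_mul]
      field_simp
    · rw [← hA2, Finset.sum_congr rfl (fun v hv => by rw [hout v hv, key _ h2]),
        Finset.sum_const, nsmul_eq_mul]
      field_simp
  rw [e1, e2, ← hcard, add_div]
  linarith

theorem pot_nonneg {V : Type*} [Fintype V] (θ : ℝ) (F : Finset (Set V)) : 0 ≤ pot θ F :=
  Finset.sum_nonneg (fun _ _ => le_max_left _ _)

open Classical in
theorem exists_family {V : Type*} [Fintype V] (θ : ℝ) (hθ : 0 < θ) (T : Set (Set V)) :
    ∃ F : Finset (Set V), (∀ X ∈ F, X ∈ T) ∧ (F.card : ℝ) ≤ Fintype.card V / θ ∧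
      ∀ X ∈ T, ∀ a, ((atomF F a).filter (fun u => u ∈ X)).card < θ ∨
        ((atomF F a).filter (fun u => u ∉ X)).card < θ := by
  let S : Finset (Finset (Set V)) := Finset.univ.filter (fun F =>
    (∀ X ∈ F, X ∈ T) ∧ (F.card : ℝ) + pot θ F ≤ Fintype.card V / θ)
  have hne : S.Nonempty := by
    refine ⟨∅, ?_⟩
    simp only [S, Finset.mem_filter, Finset.mem_univ, true_and]
    refine ⟨by simp, ?_⟩
    have : pot θ (∅ : Finset (Set V)) ≤ ∑ _v : V, 1 / θ := by
      apply Finset.sum_le_sum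
      intro v _
      have := one_div_pos.mpr (atomF_card_pos (∅ : Finset (Set V)) v)
      have := one_div_pos.mpr hθ
      apply max_le <;> linarith
    simp only [Finset.sum_const, nsmul_eq_mul, Finset.card_univ, mul_one_div] at this
    simpa using this
  obtain ⟨F, hF, hmax⟩ := Finset.exists_max_image S Finset.card hne
  simp only [S, Finset.mem_filter, Finset.mem_univ, true_and] at hF hmax
  refine ⟨F, hF.1, by linarith [hF.2, pot_nonneg θ F], ?_⟩
  intro X hX a
  by_contra hcon
  push Not at hcon
  obtain ⟨h1, h2⟩ := hcon
  have hnot : X ∉ F := by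
    intro hXF
    obtain ⟨u, hu⟩ := Finset.card_pos.mp (by exact_mod_cast lt_of_lt_of_le hθ h1)
    obtain ⟨v, hv⟩ := Finset.card_pos.mp (by exact_mod_cast lt_of_lt_of_le hθ h2)
    rw [Finset.mem_filter, mem_atomF] at hu hv
    have := hu.1 X hXF
    have := hv.1 X hXF
    tauto
  have hst := pot_step θ hθ F X a h1 h2
  have hc := Finset.card_insert_of_notMem hnot
  have := hmax (insert X F) ⟨by
    intro Y hY
    rcases Finset.mem_insert.mp hY with rfl | hY
    · exact hX
    · exact hF.1 Y hY, by rw [hc]; push_cast; linarith [hF.2]⟩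
  omega

open Classical in
theorem cut_diff {V : Type*} [Fintype V] (w : V → V → ℝ) (hsymm : ∀ u v, w u v = w v u)
    (hloop : ∀ u, w u u = 0) (X : Set V) (v : V) (hv : v ∈ X) :
    cutWeight w X + ∑ b, (if b ∈ X then w v b else 0) =
      cutWeight w (X \ {v}) + ∑ b, (if b ∉ X then w v b else 0) := by
  have e1 : ∑ b, (if b ∈ X then w v b else 0) =
      ∑ a, ∑ b, if b = v then (if a ∈ X then w a b else 0) else 0 := by
    apply Finset.sum_congr rfl
    intro a _
    rw [Finset.sum_ite_eq' Finset.univ v]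
    simp [hsymm v a]
  have e2 : ∑ b, (if b ∉ X then w v b else 0) =
      ∑ a, ∑ b, if a = v then (if b ∉ X then w a b else 0) else 0 := by
    rw [Finset.sum_comm]
    apply Finset.sum_congr rfl
    intro b _
    rw [Finset.sum_ite_eq' Finset.univ v]
    simp
  rw [e1, e2]
  unfold cutWeight
  simp only [← Finset.sum_add_distrib]
  apply Finset.sum_congr rfl
  intro a _
  apply Finset.sum_congr rfl
  intro b _
  by_cases ha : a = v <;> by_cases hb : b = v <;> by_cases haX : a ∈ X <;> by_cases hbX : b ∈ X <;>
    simp_all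

open Classical in
theorem bad_vertex {V : Type*} [Fintype V]
    (w : V → V → ℝ) (hsymm : ∀ u v, w u v = w v u) (hnn : ∀ u v, 0 ≤ w u v)
    (hloop : ∀ u, w u u = 0) (τ : ℝ) (hτ : ∀ u v, w u v ≤ τ) (hτ0 : 0 ≤ τ)
    (δ lam θ : ℝ) (F : Finset (Set V)) (X : Set V) (v : V) (hv : v ∈ X)
    (hlam : lam ≤ cutWeight w (X \ {v})) (hX : cutWeight w X ≤ lam + δ)
    (hs : ((atomF F v).filter (fun u => u ∈ X)).card < θ) :
    ∑ b, (if sameAtom (F : Set (Set V)) v b then w v b else 0) ≤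
      ∑ b, (if ¬ sameAtom (F : Set (Set V)) v b then w v b else 0) + δ + 2 * (θ * τ) := by
  have h0 := cut_diff w hsymm hloop X v hv
  have h1 : ∑ b, (if sameAtom (F : Set (Set V)) v b ∧ b ∈ X then w v b else 0) ≤ θ * τ := by
    rw [← Finset.sum_filter]
    calc _ ≤ ∑ b ∈ Finset.univ.filter (fun b => sameAtom (F : Set (Set V)) v b ∧ b ∈ X), τ :=
          Finset.sum_le_sum (fun b _ => hτ v b)
      _ = ((atomF F v).filter (fun u => u ∈ X)).card * τ := by
          rw [Finset.sum_const, nsmul_eq_mul, atomF, Finset.filter_filter]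
      _ ≤ θ * τ := mul_le_mul_of_nonneg_right hs.le hτ0
  have h2 : ∑ b, (if sameAtom (F : Set (Set V)) v b then w v b else 0) ≤
      ∑ b, (if b ∉ X then w v b else 0) +
      ∑ b, (if sameAtom (F : Set (Set V)) v b ∧ b ∈ X then w v b else 0) := by
    rw [← Finset.sum_add_distrib]
    apply Finset.sum_le_sum
    intro b _
    have := hnn v b
    by_cases hb : b ∈ X <;> by_cases hc : sameAtom (F : Set (Set V)) v b <;> simp [hb, hc, this]
  have h3 : ∑ b, (if b ∈ X then w v b else 0) ≤
      ∑ b, (if ¬ sameAtom (F : Set (Set V)) v b then w v b else 0) +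
      ∑ b, (if sameAtom (F : Set (Set V)) v b ∧ b ∈ X then w v b else 0) := by
    rw [← Finset.sum_add_distrib]
    apply Finset.sum_le_sum
    intro b _
    have := hnn v b
    by_cases hb : b ∈ X <;> by_cases hc : sameAtom (F : Set (Set V)) v b <;> simp [hb, hc, this]
  linarith

open Classical in
theorem family_weight {V : Type*} [Fintype V]
    (w : V → V → ℝ) (hsymm : ∀ u v, w u v = w v u) (hnn : ∀ u v, 0 ≤ w u v)
    (c : ℝ) (F : Finset (Set V)) (hF : ∀ X ∈ F, cutWeight w X ≤ c) :
    ∑ u, ∑ v, (if ¬ sameAtom (F : Set (Set V)) u v then w u v else 0) ≤ 2 * (F.card * c) := by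
  have h1 : ∀ u v, (if ¬ sameAtom (F : Set (Set V)) u v then w u v else 0) ≤
      ∑ X ∈ F, ((if u ∈ X ∧ v ∉ X then w u v else 0) + (if v ∈ X ∧ u ∉ X then w v u else 0)) := by
    intro u v
    have hn : ∀ X ∈ F, 0 ≤ ((if u ∈ X ∧ v ∉ X then w u v else 0) +
        (if v ∈ X ∧ u ∉ X then w v u else 0)) := by
      intro X _
      have := hnn u v
      have := hnn v u
      split_ifs <;> linarith
    by_cases h : ¬ sameAtom (F : Set (Set V)) u v
    · rw [if_pos h]
      simp only [sameAtom, not_forall] at h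
      obtain ⟨X, hX, hne⟩ := h
      refine le_trans ?_ (Finset.single_le_sum hn hX)
      have hs := hsymm u v
      by_cases hu : u ∈ X <;> by_cases hv : v ∈ X
      · exact absurd (iff_of_true hu hv) hne
      · simp [hu, hv]
      · simp [hu, hv, hs.le]
      · exact absurd (iff_of_false hu hv) hne
    · rw [if_neg h]
      exact Finset.sum_nonneg hn
  calc _ ≤ ∑ u, ∑ v, ∑ X ∈ F, ((if u ∈ X ∧ v ∉ X then w u v else 0) +
          (if v ∈ X ∧ u ∉ X then w v u else 0)) :=
        Finset.sum_le_sum (fun u _ => Finset.sum_le_sum (fun v _ => h1 u v))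
    _ = ∑ X ∈ F, ∑ u, ∑ v, ((if u ∈ X ∧ v ∉ X then w u v else 0) +
          (if v ∈ X ∧ u ∉ X then w v u else 0)) := by
        rw [Finset.sum_comm]
        rw [Finset.sum_congr rfl (fun v _ => Finset.sum_comm)]
        rw [Finset.sum_comm]
        exact Finset.sum_congr rfl (fun X _ => Finset.sum_comm)
    _ = ∑ X ∈ F, 2 * cutWeight w X := by
        apply Finset.sum_congr rfl
        intro X _
        simp only [Finset.sum_add_distrib]
        rw [Finset.sum_comm (f := fun u v => if v ∈ X ∧ u ∉ X then w v u else 0)]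
        unfold cutWeight
        ring
    _ ≤ ∑ X ∈ F, 2 * c := Finset.sum_le_sum (fun X hX => by linarith [hF X hX])
    _ = 2 * (F.card * c) := by rw [Finset.sum_const, nsmul_eq_mul]; ring

open Classical in
theorem cut_singleton {V : Type*} [Fintype V] (w : V → V → ℝ) (hloop : ∀ u, w u u = 0) (u : V) :
    cutWeight w {u} = ∑ v, w u v := by
  unfold cutWeight
  rw [Finset.sum_eq_single u]
  · apply Finset.sum_congr rfl
    intro v _
    by_cases h : v = u
    · subst h; simp [hloop]
    · simp [h]
  · intro b _ hb
    simp [hb]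
  · simp

open Classical in
theorem stmt_9 {V : Type*} [Fintype V] [Nonempty V]
    (w : V → V → ℝ) (hsymm : ∀ u v, w u v = w v u) (hnn : ∀ u v, 0 ≤ w u v)
    (hloop : ∀ u, w u u = 0)
    -- every edge has weight at most `τ`
    (τ : ℝ) (hτ : ∀ u v, w u v ≤ τ)
    (ε : ℝ) (hε0 : 0 ≤ ε) (hε1 : ε < 1)
    -- `d` is the minimum weighted degree
    (d : ℝ) (hd : IsLeast (Set.range fun u : V => cutWeight w {u}) d)
    -- `lam = λ(G)` is the weight of a minimum cut
    (lam : ℝ)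
    (hlam : IsLeast {x : ℝ | ∃ X : Set V, X ≠ ∅ ∧ X ≠ Set.univ ∧ x = cutWeight w X} lam)
    -- `T` is the set of shores of all non-star near-minimum cuts
    (T : Set (Set V))
    (hT : T = {X : Set V | 2 ≤ X.ncard ∧ 2 ≤ Xᶜ.ncard ∧ cutWeight w X ≤ lam + ε * d}) :
    -- the total edge weight of `G' = Contract(G, atoms(T))`, namely the total weight of
    -- edges of `G` whose endpoints lie in different atoms of `T`, is at most `68τn/(1-ε)²`
    (∑ u : V, ∑ v : V, if ¬ sameAtom T u v then w u v else 0) / 2 ≤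
      68 * τ * (Fintype.card V) / (1 - ε) ^ 2 := by
  have hτ0 : 0 ≤ τ := by
    obtain ⟨u⟩ := ‹Nonempty V›
    simpa [hloop] using hτ u u
  have hcutnn : ∀ X, 0 ≤ cutWeight w X := by
    intro X
    apply Finset.sum_nonneg
    intro u _
    apply Finset.sum_nonneg
    intro v _
    split_ifs
    · exact hnn u v
    · exact le_rfl
  have hd0 : 0 ≤ d := by
    obtain ⟨u, hu⟩ := hd.1
    rw [← hu]
    exact hcutnn _
  have hα : 0 < 1 - ε := by linarith
  have hlamd : lam ≤ d := by
    obtain ⟨u, hu⟩ := hd.1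
    obtain ⟨X, hX0, hX1, -⟩ := hlam.1
    rw [← hu]
    apply hlam.2
    refine ⟨{u}, Set.singleton_ne_empty u, ?_, rfl⟩
    intro hun
    obtain ⟨x, hx⟩ := Set.nonempty_iff_ne_empty.mpr hX0
    apply hX1
    rw [← hun]
    have hall : ∀ y : V, y = u := fun y => by
      have : y ∈ ({u} : Set V) := hun ▸ Set.mem_univ y
      simpa using this
    ext y
    rw [hall y]
    rw [hall x] at hx
    simp [hx]
  have hrhs : 0 ≤ 68 * τ * (Fintype.card V) / (1 - ε) ^ 2 := by positivity
  have hTc : ∀ X ∈ T, Xᶜ ∈ T := by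
    intro X hX
    rw [hT] at hX ⊢
    obtain ⟨h1, h2, h3⟩ := hX
    refine ⟨h2, by rwa [compl_compl], ?_⟩
    have : cutWeight w Xᶜ = cutWeight w X := by
      unfold cutWeight
      rw [Finset.sum_comm]
      apply Finset.sum_congr rfl
      intro u _
      apply Finset.sum_congr rfl
      intro v _
      rw [hsymm v u]
      congr 1
      simp [and_comm]
    rw [this]
    exact h3
  -- degenerate case `θ = 0`
  rcases eq_or_lt_of_le (mul_nonneg hd0 hτ0) with h0 | hpos
  · have hz : ∀ u v, (if ¬ sameAtom T u v then w u v else 0) = 0 := by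
      intro u v
      by_cases h : ¬ sameAtom T u v
      · rw [if_pos h]
        rcases mul_eq_zero.mp h0.symm with h0 | h0
        · simp only [sameAtom, not_forall] at h
          obtain ⟨X, hX, hne⟩ := h
          have hX' : cutWeight w X ≤ 0 := by
            rw [hT] at hX
            have := hX.2.2
            rw [h0] at this hlamd
            linarith
          have hle : ∀ a b, a ∈ X → b ∉ X → w a b ≤ 0 := by
            intro a b ha hb
            refine le_trans ?_ hX'
            unfold cutWeight
            have hp : ∀ x y : V, 0 ≤ (if x ∈ X ∧ y ∉ X then w x y else 0) := by
              intro x y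
              split_ifs
              · exact hnn x y
              · exact le_rfl
            refine le_trans ?_ (Finset.single_le_sum
              (fun x _ => Finset.sum_nonneg (fun y _ => hp x y)) (Finset.mem_univ a))
            refine le_trans ?_ (Finset.single_le_sum (fun y _ => hp a y) (Finset.mem_univ b))
            simp [ha, hb]
          apply le_antisymm _ (hnn u v)
          by_cases hu : u ∈ X
          · exact hle u v hu (by tauto)
          · rw [hsymm]
            exact hle v u (by tauto) hu
        · exact le_antisymm (h0 ▸ hτ u v) (hnn u v)
      · rw [if_neg h]
    simp only [hz, Finset.sum_const_zero, zero_div]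
    exact hrhs
  have hdpos : 0 < d := lt_of_le_of_ne hd0 (by rintro rfl; simp at hpos)
  have hτpos : 0 < τ := lt_of_le_of_ne hτ0 (by rintro rfl; simp at hpos)
  obtain ⟨θ, hθ⟩ : ∃ θ, θ = (1 - ε) * d / (4 * τ) := ⟨_, rfl⟩
  have hθpos : 0 < θ := by rw [hθ]; positivity
  have hθτ : θ * τ = (1 - ε) * d / 4 := by rw [hθ]; field_simp
  obtain ⟨F, hFT, hFc, hFs⟩ := exists_family θ hθpos T
  have hTcut : ∀ X ∈ T, cutWeight w X ≤ lam + ε * d := by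
    intro X hX
    rw [hT] at hX
    exact hX.2.2
  obtain ⟨dout, hdout⟩ : ∃ f : V → ℝ, f = fun v =>
    ∑ b, (if ¬ sameAtom (F : Set (Set V)) v b then w v b else 0) := ⟨_, rfl⟩
  obtain ⟨din, hdin⟩ : ∃ f : V → ℝ, f = fun v =>
    ∑ b, (if sameAtom (F : Set (Set V)) v b then w v b else 0) := ⟨_, rfl⟩
  have hdout0 : ∀ v, 0 ≤ dout v := by
    intro v
    rw [hdout]
    apply Finset.sum_nonneg
    intro b _
    have := hnn v b
    split_ifs <;> linarith
  have hW : ∑ v, dout v ≤ 2 * (F.card * (lam + ε * d)) := by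
    rw [hdout]
    exact family_weight w hsymm hnn _ F (fun X hX => hTcut X (hFT X hX))
  have hdeg : ∀ v, d ≤ din v + dout v := by
    intro v
    have h1 : d ≤ cutWeight w {v} := hd.2 ⟨v, rfl⟩
    rw [cut_singleton w hloop] at h1
    rw [hdin, hdout]
    simp only [← Finset.sum_add_distrib]
    refine h1.trans (le_of_eq ?_)
    apply Finset.sum_congr rfl
    intro b _
    split_ifs <;> simp_all
  obtain ⟨bad, hbaddef⟩ : ∃ bad : V → Prop, bad = fun v =>
    ∃ X ∈ T, v ∈ X ∧ (((atomF F v).filter (fun u => u ∈ X)).card : ℝ) < θ := ⟨_, rfl⟩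
  have hbad : ∀ v, bad v → din v ≤ (4 - (1 - ε)) / (1 - ε) * dout v := by
    intro v hv
    rw [hbaddef] at hv
    obtain ⟨X, hXT, hvX, hs⟩ := hv
    have hl : lam ≤ cutWeight w (X \ {v}) := by
      apply hlam.2
      refine ⟨X \ {v}, ?_, ?_, rfl⟩
      · intro he
        rw [hT] at hXT
        have h2 := hXT.1
        have h3 : X ⊆ {v} := Set.sdiff_eq_empty.mp he
        have h4 := Set.ncard_le_ncard h3
        rw [Set.ncard_singleton] at h4
        omega
      · intro he
        have : v ∈ X \ {v} := he ▸ Set.mem_univ v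
        exact this.2 rfl
    have h1 := bad_vertex w hsymm hnn hloop τ hτ hτ0 (ε * d) lam θ F X v hvX hl (hTcut X hXT) hs
    have h1' : din v ≤ dout v + ε * d + 2 * (θ * τ) := by rw [hdin, hdout]; exact h1
    have h2 := hdeg v
    rw [hθτ] at h1'
    have h3 : (1 - ε) * d ≤ 4 * dout v := by linarith
    rw [div_mul_eq_mul_div, le_div_iff₀ hα]
    have h4 := mul_le_mul_of_nonneg_right h1' hα.le
    nlinarith [mul_le_mul_of_nonneg_left h3 hε0]
  have hpair : ∀ u v, (if ¬ sameAtom T u v then w u v else 0) ≤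
      (if ¬ sameAtom (F : Set (Set V)) u v then w u v else 0) +
      ((if bad u then (if sameAtom (F : Set (Set V)) u v then w u v else 0) else 0) +
      (if bad v then (if sameAtom (F : Set (Set V)) v u then w v u else 0) else 0)) := by
    intro u v
    have hw := hnn u v
    have hw' := hsymm u v
    by_cases hF : sameAtom (F : Set (Set V)) u v
    · have hF' := sameAtom_symm' hF
      by_cases hTs : sameAtom T u v
      · simp only [hF, hF', hTs, not_true_eq_false, if_true, if_false]
        split_ifs <;> linarith
      · have hb : bad u ∨ bad v := by
          have h := hTs
          simp only [sameAtom, not_forall] at h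
          obtain ⟨X, hX, hne⟩ := h
          have hat : atomF F v = atomF F u := atomF_eq F ((mem_atomF F u v).mpr hF)
          rw [hbaddef]
          rcases hFs X hX u with h1 | h1
          · by_cases hu : u ∈ X
            · exact Or.inl ⟨X, hX, hu, h1⟩
            · exact Or.inr ⟨X, hX, by tauto, by rw [hat]; exact h1⟩
          · by_cases hu : u ∈ X
            · exact Or.inr ⟨Xᶜ, hTc X hX, by simp; tauto, by rw [hat]; simpa using h1⟩
            · exact Or.inl ⟨Xᶜ, hTc X hX, hu, by simpa using h1⟩
        simp only [hF, hF', hTs, not_true_eq_false, not_false_eq_true, if_true, if_false]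
        rcases hb with hb | hb <;> simp only [hb, if_true] <;> split_ifs <;> linarith
    · have hF' : ¬ sameAtom (F : Set (Set V)) v u := fun h => hF (sameAtom_symm' h)
      simp only [hF, hF', not_false_eq_true, if_true, if_false, ite_self, add_zero]
      split_ifs <;> linarith
  have hB : ∑ u, ∑ v, (if bad u then (if sameAtom (F : Set (Set V)) u v then w u v else 0) else 0)
      ≤ (4 - (1 - ε)) / (1 - ε) * ∑ v, dout v := by
    rw [Finset.mul_sum]
    apply Finset.sum_le_sum
    intro u _
    by_cases hu : bad u
    · simp only [hu, if_true]
      have := hbad u hu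
      rw [hdin] at this
      exact this
    · simp only [hu, if_false, Finset.sum_const_zero]
      have : 0 ≤ (4 - (1 - ε)) / (1 - ε) := div_nonneg (by linarith) hα.le
      exact mul_nonneg this (hdout0 u)
  have htot : ∑ u : V, ∑ v : V, (if ¬ sameAtom T u v then w u v else 0) ≤
      ∑ v, dout v + 2 * ((4 - (1 - ε)) / (1 - ε) * ∑ v, dout v) := by
    refine (Finset.sum_le_sum (fun u _ => Finset.sum_le_sum (fun v _ => hpair u v))).trans ?_
    simp only [Finset.sum_add_distrib]
    rw [Finset.sum_comm (f := fun u v =>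
      if bad v then (if sameAtom (F : Set (Set V)) v u then w v u else 0) else 0)]
    have : ∑ v, dout v = ∑ u, ∑ v, (if ¬ sameAtom (F : Set (Set V)) u v then w u v else 0) := by
      rw [hdout]
    linarith
  obtain ⟨W, hWd⟩ : ∃ W, W = ∑ v, dout v := ⟨_, rfl⟩
  rw [← hWd] at htot hW
  have hn0 : (0 : ℝ) ≤ Fintype.card V := by positivity
  have hW2 : W * (1 - ε) ≤ 8 * τ * Fintype.card V * (1 + ε) := by
    have h1 : (F.card : ℝ) * (lam + ε * d) ≤ Fintype.card V / θ * (d + ε * d) := by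
      apply mul_le_mul hFc (by linarith) _ (by positivity)
      obtain ⟨X, _, _, hX⟩ := hlam.1
      have := hcutnn X
      have := mul_nonneg hε0 hd0
      linarith
    have h2 : (Fintype.card V : ℝ) / θ * (d + ε * d) * (1 - ε) = 4 * τ * Fintype.card V * (1 + ε) := by
      rw [hθ]
      field_simp
    have h3 := mul_le_mul_of_nonneg_right (hW.trans (mul_le_mul_of_nonneg_left h1 (by norm_num : (0:ℝ) ≤ 2))) hα.le
    linarith
  rw [le_div_iff₀ (by positivity)]
  have h5 : (W + 2 * ((4 - (1 - ε)) / (1 - ε) * W)) / 2 * (1 - ε) ^ 2 =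
      (W * (1 - ε)) * (7 + ε) / 2 := by
    field_simp
    ring
  have h6 := mul_le_mul_of_nonneg_right (div_le_div_of_nonneg_right htot (by norm_num : (0:ℝ) ≤ 2))
    (sq_nonneg (1 - ε))
  rw [h5] at h6
  refine h6.trans ?_
  have h7 := mul_le_mul_of_nonneg_right hW2 (by linarith : (0:ℝ) ≤ (7 + ε) / 2)
  have h8 : (1 + ε) * (7 + ε) ≤ 16 := by nlinarith
  have h9 := mul_le_mul_of_nonneg_left h8 (by positivity : 0 ≤ 4 * τ * Fintype.card V)
  have h10 : 0 ≤ τ * Fintype.card V := by positivity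
  nlinarith
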